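/- For each Φ ∈ C_c^∞(ℝ^n × ℝ^n) there exists a constant c, depending only on n and Φ, such that for all σ ∈ L^∞(ℝ^n × ℝ^n) and all sequences (α_μ)_{μ∈ℤ^n} and (α′_ν)_{ν∈ℤ^n} with values in {0,1}, one has ‖Σ_{μ,ν∈ℤ^n} α_μ α′_ν Φ(ξ−μ, η−ν) σ(ξ,η)‖_{M(L²×L² → (L²,ℓ^∞))} ≤ c ‖σ‖_{M(L²×L² → (L²,ℓ^∞))}. -/

import Mathlib

open MeasureTheory Complex
open scoped ENNReal NNReal

noncomputable section

abbrev Rn (n : ℕ) : Type := Fin n → ℝ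
abbrev Zn (n : ℕ) : Type := Fin n → ℤ

/-- Coercion of a lattice point to a point of `ℝ^n`. -/
def coeZ {n : ℕ} (μ : Zn n) : Rn n := fun i => (μ i : ℝ)

/-- The cube `aQ = [-a/2, a/2]^n`. -/
def cube (n : ℕ) (a : ℝ) : Set (Rn n) := Set.univ.pi fun _ => Set.Icc (-a / 2) (a / 2)

/-- A smooth compactly supported function. -/
def IsCcInfty {E : Type*} [NormedAddCommGroup E] [NormedSpace ℝ E] (Φ : E → ℂ) : Prop :=
  ContDiff ℝ (⊤ : ℕ∞) Φ ∧ HasCompactSupport Φ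

/-- The Fourier transform of a Schwartz function. -/
def ft {n : ℕ} (f : SchwartzMap (Rn n) ℂ) (ξ : Rn n) : ℂ :=
  ∫ x : Rn n, Complex.exp ((-2 * Real.pi * Complex.I) * ((∑ i, x i * ξ i : ℝ) : ℂ)) * f x

/-- The bilinear Fourier multiplier operator `T_σ(f,g)`. -/
def Tbil {n : ℕ} (σ : Rn n × Rn n → ℂ) (f g : SchwartzMap (Rn n) ℂ) (x : Rn n) : ℂ :=
  ∫ p : Rn n × Rn n,
    Complex.exp ((2 * Real.pi * Complex.I) * ((∑ i, x i * (p.1 i + p.2 i) : ℝ) : ℂ)) *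
      σ p * ft f p.1 * ft g p.2

/-- `L²` norm of `h(·+ν)` on the unit cube `Q`. -/
def localL2 {n : ℕ} (h : Rn n → ℂ) (ν : Zn n) : ℝ≥0∞ :=
  (∫⁻ x in cube n 1, (‖h (x + coeZ ν)‖₊ : ℝ≥0∞) ^ 2) ^ (1 / 2 : ℝ)

/-- The amalgam `(L², ℓ^q)` norm. -/
def amalgamNorm {n : ℕ} (q : ℝ≥0∞) (h : Rn n → ℂ) : ℝ≥0∞ :=
  if q = ∞ then ⨆ ν : Zn n, localL2 h ν
  else (∑' ν : Zn n, localL2 h ν ^ q.toReal) ^ (1 / q.toReal)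

/-- The multiplier norm `‖σ‖_{M(L²×L² → (L²,ℓ^q))}`. -/
def multNorm {n : ℕ} (q : ℝ≥0∞) (σ : Rn n × Rn n → ℂ) : ℝ≥0∞ :=
  ⨆ (f : SchwartzMap (Rn n) ℂ) (g : SchwartzMap (Rn n) ℂ)
    (_ : eLpNorm (⇑f) 2 volume = 1) (_ : eLpNorm (⇑g) 2 volume = 1),
    amalgamNorm q (Tbil σ f g)

/-- An `L^∞` matrix on `ℤ^n × ℤ^n`. -/
def IsLinftyMatrix {n : ℕ} (A : Zn n → Zn n → ℂ) : Prop :=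
  ∃ C : ℝ, ∀ μ ν, ‖A μ ν‖ ≤ C

/-- The norm `‖A‖_B`: the trilinear form norm over finitely supported unit `ℓ²` vectors. -/
def normB {n : ℕ} (A : Zn n → Zn n → ℂ) : ℝ≥0∞ :=
  ⨆ (F : Zn n →₀ ℂ) (G : Zn n →₀ ℂ) (H : Zn n →₀ ℂ)
    (_ : ∑ μ ∈ F.support, ‖F μ‖ ^ 2 = 1)
    (_ : ∑ ν ∈ G.support, ‖G ν‖ ^ 2 = 1)
    (_ : ∑ ρ ∈ H.support, ‖H ρ‖ ^ 2 = 1),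
    (‖∑ μ ∈ F.support, ∑ ν ∈ G.support, A μ ν * F μ * G ν * H (μ + ν)‖₊ : ℝ≥0∞)

/-- The multiplier `σ_{A,Φ}(ξ,η) = Σ_{μ,ν} a_{μν} Φ(ξ-μ, η-ν)`. -/
def sigmaA {n : ℕ} (A : Zn n → Zn n → ℂ) (Φ : Rn n × Rn n → ℂ) (p : Rn n × Rn n) : ℂ :=
  ∑' μν : Zn n × Zn n, A μν.1 μν.2 * Φ (p.1 - coeZ μν.1, p.2 - coeZ μν.2)

/-- Condition (A) for functions on `ℝ^d`. -/
def ConditionA {d : ℕ} (Φ : Rn d → ℂ) : Prop :=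
  ∃ Θ : Rn d → ℂ, ContDiff ℝ (⊤ : ℕ∞) Θ ∧ HasCompactSupport Θ ∧
    ∀ α : Zn d, (∫ x : Rn d, Θ x * Φ (x - coeZ α)) = if α = 0 then 1 else 0

/-- Condition (A) for functions on `ℝ^n × ℝ^n` (i.e. `d = 2n`). -/
def ConditionA2 {n : ℕ} (Φ : Rn n × Rn n → ℂ) : Prop :=
  ∃ Θ : Rn n × Rn n → ℂ, ContDiff ℝ (⊤ : ℕ∞) Θ ∧ HasCompactSupport Θ ∧
    ∀ α β : Zn n, (∫ p : Rn n × Rn n, Θ p * Φ (p.1 - coeZ α, p.2 - coeZ β)) =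
      if α = 0 ∧ β = 0 then 1 else 0

/-- Condition (A) for functions on `ℝ` (the case `d = 1`). -/
def ConditionA1 (Φ : ℝ → ℂ) : Prop :=
  ∃ θ : ℝ → ℂ, ContDiff ℝ (⊤ : ℕ∞) θ ∧ HasCompactSupport θ ∧
    ∀ j : ℤ, (∫ x : ℝ, θ x * Φ (x - (j : ℝ))) = if j = 0 then 1 else 0

/-- The `L^∞` (sup) norm, valued in `ℝ≥0∞`. -/
def supNorm {E : Type*} (u : E → ℂ) : ℝ≥0∞ := ⨆ x, (‖u x‖₊ : ℝ≥0∞)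

end

noncomputable section

open scoped FourierTransform SchwartzMap

/-- The character `e^{2πi x·ξ}`. -/
def planeWave {n : ℕ} (x ξ : Rn n) : ℂ :=
  Complex.exp ((2 * Real.pi * Complex.I) * ((∑ i, x i * ξ i : ℝ) : ℂ))

lemma norm_planeWave {n : ℕ} (x ξ : Rn n) : ‖planeWave x ξ‖ = 1 := by
  simp [planeWave, Complex.norm_exp]

lemma contDiff_planeWave {n : ℕ} :
    ContDiff ℝ (⊤ : ℕ∞) (fun p : Rn n × Rn n => planeWave p.1 p.2) := by
  unfold planeWave
  have h : ContDiff ℝ (⊤ : ℕ∞) fun p : Rn n × Rn n => ∑ i, p.1 i * p.2 i :=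
    ContDiff.sum fun i _ => by fun_prop
  exact ContDiff.cexp (contDiff_const.mul (Complex.ofRealCLM.contDiff.comp h))

lemma continuous_planeWave {n : ℕ} : Continuous (fun p : Rn n × Rn n => planeWave p.1 p.2) :=
  contDiff_planeWave.continuous

/-- A Schwartz function on `ℝ^n` read on Euclidean space. -/
def liftEuclidean {n : ℕ} (f : 𝓢(Rn n, ℂ)) : 𝓢(EuclideanSpace ℝ (Fin n), ℂ) :=
  SchwartzMap.compCLMOfContinuousLinearEquiv ℂ (EuclideanSpace.equiv (Fin n) ℝ) f

/-- A Schwartz function on Euclidean space read on `ℝ^n`. -/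
def descendEuclidean {n : ℕ} (f : 𝓢(EuclideanSpace ℝ (Fin n), ℂ)) : 𝓢(Rn n, ℂ) :=
  SchwartzMap.compCLMOfContinuousLinearEquiv ℂ (EuclideanSpace.equiv (Fin n) ℝ).symm f

lemma liftEuclidean_apply {n : ℕ} (f : 𝓢(Rn n, ℂ)) (x) :
    liftEuclidean f x = f (WithLp.ofLp x) := rfl

lemma liftEuclidean_descendEuclidean {n : ℕ} (f : 𝓢(EuclideanSpace ℝ (Fin n), ℂ)) :
    liftEuclidean (descendEuclidean f) = f := rfl

lemma eLpNorm_liftEuclidean {n : ℕ} (f : 𝓢(Rn n, ℂ)) :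
    eLpNorm (liftEuclidean f) 2 volume = eLpNorm f 2 volume :=
  eLpNorm_comp_measurePreserving f.continuous.aestronglyMeasurable
    (PiLp.volume_preserving_ofLp (Fin n))

lemma ft_eq_fourier {n : ℕ} (f : 𝓢(Rn n, ℂ)) (ξ : Rn n) :
    ft f ξ = 𝓕 (liftEuclidean f) (WithLp.toLp 2 ξ) := by
  rw [SchwartzMap.fourier_coe, Real.fourier_eq', ft,
    ← (PiLp.volume_preserving_ofLp (Fin n)).integral_comp
      (MeasurableEquiv.toLp 2 (Fin n → ℝ)).symm.measurableEmbedding]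
  refine integral_congr_ae (Filter.Eventually.of_forall fun x => ?_)
  simp only [liftEuclidean_apply, smul_eq_mul, PiLp.inner_apply, RCLike.inner_apply, conj_trivial]
  congr 2
  push_cast
  simp_rw [mul_comm (ξ _ : ℂ)]
  ring

lemma exists_schwartz_eq_ft {n : ℕ} (f : 𝓢(Rn n, ℂ)) : ∃ F : 𝓢(Rn n, ℂ), ft f = F :=
  ⟨descendEuclidean (𝓕 (liftEuclidean f)), funext fun ξ => ft_eq_fourier f ξ⟩

lemma integrable_ft {n : ℕ} (f : 𝓢(Rn n, ℂ)) : Integrable (ft f) := by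
  obtain ⟨F, hF⟩ := exists_schwartz_eq_ft f
  exact hF ▸ F.integrable

lemma measurable_ft {n : ℕ} (f : 𝓢(Rn n, ℂ)) : Measurable (ft f) := by
  obtain ⟨F, hF⟩ := exists_schwartz_eq_ft f
  exact hF ▸ F.continuous.measurable

lemma ft_smul {n : ℕ} (a : ℂ) (f : 𝓢(Rn n, ℂ)) (ξ : Rn n) : ft (a • f) ξ = a * ft f ξ := by
  simp only [ft, smul_apply, smul_eq_mul, ← integral_const_mul]
  congr 1
  ext x
  ring

lemma eLpNorm_fourier_eq {n : ℕ} (f : 𝓢(EuclideanSpace ℝ (Fin n), ℂ)) :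
    eLpNorm (𝓕 f : 𝓢(EuclideanSpace ℝ (Fin n), ℂ)) 2 volume = eLpNorm f 2 volume := by
  have h : ‖(𝓕 f : 𝓢(EuclideanSpace ℝ (Fin n), ℂ)).toLp 2 volume‖ = ‖f.toLp 2 volume‖ :=
    SchwartzMap.norm_fourier_toL2_eq f
  rw [SchwartzMap.norm_toLp, SchwartzMap.norm_toLp] at h
  have h₁ : eLpNorm (𝓕 f : 𝓢(EuclideanSpace ℝ (Fin n), ℂ)) 2 volume ≠ ∞ :=
    (SchwartzMap.memLp (𝓕 f : 𝓢(EuclideanSpace ℝ (Fin n), ℂ)) 2 volume).eLpNorm_ne_top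
  have h₂ : eLpNorm f 2 volume ≠ ∞ := (f.memLp 2 volume).eLpNorm_ne_top
  rwa [← ENNReal.toReal_eq_toReal_iff' h₁ h₂]

/-- Smooth compactly supported Fourier multipliers act on Schwartz functions, with `L²` norm at
most the supremum of the multiplier. -/
lemma exists_ft_eq_mul {n : ℕ} {m : Rn n → ℂ} (hm : ContDiff ℝ (⊤ : ℕ∞) m)
    (hs : HasCompactSupport m) {C : ℝ≥0} (hC : ∀ ξ, ‖m ξ‖ ≤ C) (f : 𝓢(Rn n, ℂ)) :
    ∃ f₁ : 𝓢(Rn n, ℂ), (∀ ξ, ft f₁ ξ = m ξ * ft f ξ) ∧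
      eLpNorm f₁ 2 volume ≤ C * eLpNorm f 2 volume := by
  let F : 𝓢(EuclideanSpace ℝ (Fin n), ℂ) := 𝓕 (liftEuclidean f)
  have hcd : ContDiff ℝ (⊤ : ℕ∞) fun v : EuclideanSpace ℝ (Fin n) => m (WithLp.ofLp v) * F v :=
    (hm.comp (EuclideanSpace.equiv (Fin n) ℝ).contDiff).mul (F.smooth ⊤)
  have hcs : HasCompactSupport fun v : EuclideanSpace ℝ (Fin n) => m (WithLp.ofLp v) * F v :=
    (hs.comp_homeomorph (EuclideanSpace.equiv (Fin n) ℝ).toHomeomorph).mul_right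
  let G : 𝓢(EuclideanSpace ℝ (Fin n), ℂ) := hcs.toSchwartzMap hcd
  have hGapp : ∀ v, G v = m (WithLp.ofLp v) * F v := fun v => rfl
  refine ⟨descendEuclidean (𝓕⁻ G), fun ξ => ?_, ?_⟩
  · rw [ft_eq_fourier, ft_eq_fourier, liftEuclidean_descendEuclidean,
      FourierTransform.fourier_fourierInv_eq, hGapp]
  · rw [← eLpNorm_liftEuclidean, ← eLpNorm_liftEuclidean f, liftEuclidean_descendEuclidean,
      ← eLpNorm_fourier_eq, ← eLpNorm_fourier_eq (liftEuclidean f),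
      FourierTransform.fourier_fourierInv_eq]
    refine (eLpNorm_le_nnreal_smul_eLpNorm_of_ae_le_mul (c := C)
      (Filter.Eventually.of_forall fun v => ?_) 2)
    rw [hGapp, nnnorm_mul]
    gcongr
    exact hC _

/-- Fourier inversion in product form. -/
lemma exists_integral_planeWave {n : ℕ} {Φ : Rn n × Rn n → ℂ} (hΦ : IsCcInfty Φ) :
    ∃ W : EuclideanSpace ℝ (Fin n ⊕ Fin n) → ℂ, Integrable W ∧ Measurable W ∧ ∀ ξ η,
      Φ (ξ, η) = ∫ w, W w * (planeWave (fun i => w (Sum.inl i)) ξ *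
        planeWave (fun i => w (Sum.inr i)) η) := by
  let A : EuclideanSpace ℝ (Fin n ⊕ Fin n) ≃L[ℝ] Rn n × Rn n :=
    (EuclideanSpace.equiv (Fin n ⊕ Fin n) ℝ).trans
      (ContinuousLinearEquiv.sumPiEquivProdPi ℝ (Fin n) (Fin n) fun _ => ℝ)
  have hcs : HasCompactSupport (Φ ∘ A) := hΦ.2.comp_homeomorph A.toHomeomorph
  let Ψ : 𝓢(EuclideanSpace ℝ (Fin n ⊕ Fin n), ℂ) := hcs.toSchwartzMap (hΦ.1.comp A.contDiff)
  let W : 𝓢(EuclideanSpace ℝ (Fin n ⊕ Fin n), ℂ) := 𝓕 Ψ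
  refine ⟨W, W.integrable, W.continuous.measurable, fun ξ η => ?_⟩
  have h1 : Φ (ξ, η) = Ψ (A.symm (ξ, η)) := by
    change _ = Φ (A (A.symm (ξ, η)))
    rw [A.apply_symm_apply]
  rw [h1]
  conv_lhs => rw [← FourierTransform.fourierInv_fourier_eq
    (F := 𝓢(EuclideanSpace ℝ (Fin n ⊕ Fin n), ℂ)) Ψ]
  rw [SchwartzMap.fourierInv_coe, Real.fourierInv_eq']
  refine integral_congr_ae (Filter.Eventually.of_forall fun w => ?_)
  have hl : ∀ i, A.symm (ξ, η) (Sum.inl i) = ξ i := fun i => rfl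
  have hr : ∀ i, A.symm (ξ, η) (Sum.inr i) = η i := fun i => rfl
  simp only [smul_eq_mul, PiLp.inner_apply, RCLike.inner_apply, conj_trivial, Fintype.sum_sum_type,
    hl, hr, planeWave, ← Complex.exp_add]
  rw [mul_comm]
  congr 2
  push_cast
  simp_rw [mul_comm (ξ _ : ℂ), mul_comm (η _ : ℂ)]
  ring

lemma localL2_le_iff {n : ℕ} {h : Rn n → ℂ} {ν : Zn n} {c : ℝ≥0∞} :
    localL2 h ν ≤ c ↔ ∫⁻ x in cube n 1, ‖h (x + coeZ ν)‖ₑ ^ 2 ≤ c ^ 2 := by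
  rw [localL2, one_div, ENNReal.rpow_inv_le_iff two_pos, ENNReal.rpow_ofNat]
  rfl

lemma localL2_const_mul {n : ℕ} (a : ℂ) (h : Rn n → ℂ) (ν : Zn n) :
    localL2 (fun x => a * h x) ν = ‖a‖ₑ * localL2 h ν := by
  simp only [localL2, nnnorm_mul, ENNReal.coe_mul, mul_pow]
  rw [lintegral_const_mul' _ _ (by finiteness), ENNReal.mul_rpow_of_nonneg _ _ (by norm_num)]
  congr 1
  rw [← ENNReal.rpow_natCast, ← ENNReal.rpow_mul]
  norm_num
  rfl

lemma Tbil_smul_smul {n : ℕ} (σ : Rn n × Rn n → ℂ) (a b : ℂ) (f g : 𝓢(Rn n, ℂ)) :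
    Tbil σ (a • f) (b • g) = fun x => (a * b) * Tbil σ f g x := by
  ext x
  simp only [Tbil, ft_smul, ← integral_const_mul]
  congr 1
  ext p
  ring

lemma exists_normalized {n : ℕ} (f : 𝓢(Rn n, ℂ)) (hf : eLpNorm f 2 volume ≠ 0) :
    ∃ (a : ℂ) (f₁ : 𝓢(Rn n, ℂ)), f = a • f₁ ∧ eLpNorm f₁ 2 volume = 1 ∧
      ‖a‖ₑ = eLpNorm f 2 volume := by
  have hfin : eLpNorm f 2 volume ≠ ∞ := (f.memLp 2 volume).eLpNorm_ne_top
  set a : ℂ := ((eLpNorm f 2 volume).toReal : ℂ) with ha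
  have hna : ‖a‖ₑ = eLpNorm f 2 volume := by
    rw [ha, ← ofReal_norm, Complex.norm_real, Real.norm_of_nonneg ENNReal.toReal_nonneg,
      ENNReal.ofReal_toReal hfin]
  have ha0 : a ≠ 0 := by
    rw [← enorm_ne_zero, hna]
    exact hf
  refine ⟨a, a⁻¹ • f, by rw [smul_smul, mul_inv_cancel₀ ha0, one_smul], ?_, hna⟩
  have h : ⇑(a⁻¹ • f) = a⁻¹ • ⇑f := rfl
  rw [h, eLpNorm_const_smul, enorm_inv ha0, hna, ENNReal.inv_mul_cancel hf hfin]

lemma ft_eq_zero {n : ℕ} {f : 𝓢(Rn n, ℂ)} (hf : eLpNorm f 2 volume = 0) (ξ : Rn n) :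
    ft f ξ = 0 := by
  rw [eLpNorm_eq_zero_iff f.continuous.aestronglyMeasurable two_ne_zero] at hf
  rw [ft, integral_eq_zero_of_ae]
  filter_upwards [hf] with x hx
  simp [hx]

lemma localL2_Tbil_le {n : ℕ} (σ : Rn n × Rn n → ℂ) (f g : 𝓢(Rn n, ℂ)) (ν : Zn n) :
    localL2 (Tbil σ f g) ν ≤ multNorm ⊤ σ * (eLpNorm f 2 volume * eLpNorm g 2 volume) := by
  by_cases h : eLpNorm f 2 volume = 0 ∨ eLpNorm g 2 volume = 0
  · have hT : Tbil σ f g = fun _ => 0 := by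
      ext x
      rcases h with h | h <;> simp [Tbil, ft_eq_zero h]
    simp [hT, localL2]
  push Not at h
  obtain ⟨a, f₁, rfl, hf₁, ha⟩ := exists_normalized f h.1
  obtain ⟨b, g₁, rfl, hg₁, hb⟩ := exists_normalized g h.2
  rw [← ha, ← hb, Tbil_smul_smul, localL2_const_mul, enorm_mul, mul_comm]
  gcongr
  refine le_trans ?_ (le_iSup₂_of_le f₁ g₁ (le_iSup₂_of_le hf₁ hg₁ le_rfl))
  simpa [amalgamNorm] using le_iSup (localL2 (Tbil σ f₁ g₁)) ν

lemma multNorm_top_le_iff {n : ℕ} {σ : Rn n × Rn n → ℂ} {c : ℝ≥0∞} :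
    multNorm ⊤ σ ≤ c ↔ ∀ f g : 𝓢(Rn n, ℂ), eLpNorm f 2 volume = 1 → eLpNorm g 2 volume = 1 →
      ∀ ν, localL2 (Tbil σ f g) ν ≤ c := by
  simp [multNorm, amalgamNorm, iSup_le_iff]

lemma Tbil_eq {n : ℕ} (σ : Rn n × Rn n → ℂ) (f g : 𝓢(Rn n, ℂ)) (x : Rn n) :
    Tbil σ f g x = ∫ p : Rn n × Rn n,
      planeWave x (p.1 + p.2) * σ p * ft f p.1 * ft g p.2 := rfl

lemma measurable_planeWave {n : ℕ} {α : Type*} [MeasurableSpace α] {u v : α → Rn n}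
    (hu : Measurable u) (hv : Measurable v) : Measurable fun a => planeWave (u a) (v a) :=
  continuous_planeWave.measurable.comp (hu.prodMk hv)

lemma measurable_Tbil {n : ℕ} {σ : Rn n × Rn n → ℂ} (hσ : Measurable σ) (f g : 𝓢(Rn n, ℂ)) :
    Measurable (Tbil σ f g) := by
  have h : Measurable fun q : Rn n × (Rn n × Rn n) =>
      planeWave q.1 (q.2.1 + q.2.2) * σ q.2 * ft f q.2.1 * ft g q.2.2 := by
    have h₁ : Measurable fun q : Rn n × (Rn n × Rn n) => planeWave q.1 (q.2.1 + q.2.2) :=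
      measurable_planeWave (by fun_prop) (by fun_prop)
    have h₂ := measurable_ft f
    have h₃ := measurable_ft g
    fun_prop
  exact h.stronglyMeasurable.integral_prod_right.measurable

lemma integrable_ft_mul_ft {n : ℕ} (f g : 𝓢(Rn n, ℂ)) :
    Integrable fun p : Rn n × Rn n => ‖ft f p.1‖ * ‖ft g p.2‖ :=
  (integrable_ft f).norm.mul_prod (integrable_ft g).norm

/-- Bounded pointwise limits of symbols do not increase local norms. -/
lemma localL2_Tbil_le_of_tendsto {n : ℕ} {σ : ℕ → Rn n × Rn n → ℂ} {σ' : Rn n × Rn n → ℂ}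
    (hσ : ∀ N, Measurable (σ N)) {C : ℝ} (hC : ∀ N p, ‖σ N p‖ ≤ C)
    (hlim : ∀ p, Filter.Tendsto (fun N => σ N p) Filter.atTop (nhds (σ' p)))
    (f g : 𝓢(Rn n, ℂ)) (ν : Zn n) {c : ℝ≥0∞} (hc : ∀ N, localL2 (Tbil (σ N) f g) ν ≤ c) :
    localL2 (Tbil σ' f g) ν ≤ c := by
  have hT : ∀ x, Filter.Tendsto (fun N => Tbil (σ N) f g x) Filter.atTop
      (nhds (Tbil σ' f g x)) := by
    intro x
    simp only [Tbil_eq]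
    refine tendsto_integral_of_dominated_convergence
      (fun p => C * (‖ft f p.1‖ * ‖ft g p.2‖)) (fun N => ?_)
      ((integrable_ft_mul_ft f g).const_mul C) (fun N => Filter.Eventually.of_forall fun p => ?_)
      (Filter.Eventually.of_forall fun p => ?_)
    · have h₁ : Measurable fun q : Rn n × Rn n => planeWave x (q.1 + q.2) :=
        measurable_planeWave (by fun_prop) (by fun_prop)
      have h₂ := measurable_ft f
      have h₃ := measurable_ft g
      have h₄ := hσ N
      exact Measurable.aestronglyMeasurable (by fun_prop)
    · rw [norm_mul, norm_mul, norm_mul, norm_planeWave, one_mul, mul_assoc]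
      gcongr
      exact hC N p
    · exact (((hlim p).const_mul _).mul_const _).mul_const _
  rw [localL2_le_iff]
  calc ∫⁻ x in cube n 1, ‖Tbil σ' f g (x + coeZ ν)‖ₑ ^ 2
      = ∫⁻ x in cube n 1, Filter.liminf (fun N => ‖Tbil (σ N) f g (x + coeZ ν)‖ₑ ^ 2)
          Filter.atTop := by
        congr 1
        ext x
        exact (((ENNReal.continuous_pow 2).tendsto _).comp
          (continuous_enorm.tendsto _ |>.comp (hT _))).liminf_eq.symm
    _ ≤ Filter.liminf (fun N => ∫⁻ x in cube n 1, ‖Tbil (σ N) f g (x + coeZ ν)‖ₑ ^ 2)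
          Filter.atTop := by
        refine lintegral_liminf_le fun N => ?_
        have h := measurable_Tbil (hσ N) f g
        fun_prop
    _ ≤ c ^ 2 := by
        refine Filter.liminf_le_of_frequently_le' (Filter.Frequently.of_forall fun N => ?_)
        exact localL2_le_iff.1 (hc N)

/-- Cauchy-Schwarz for an integral against a weight. -/
lemma enorm_integral_mul_sq_le {E : Type*} [MeasurableSpace E] {P : Measure E} {W u : E → ℂ}
    (hW : Measurable W) (hu : Measurable u) :
    ‖∫ w, W w * u w ∂P‖ₑ ^ 2 ≤ (∫⁻ w, ‖W w‖ₑ ∂P) * ∫⁻ w, ‖W w‖ₑ * ‖u w‖ₑ ^ 2 ∂P := by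
  have hsq : ∀ t : ℝ≥0∞, (t ^ (1 / 2 : ℝ)) ^ 2 = t := fun t => by
    rw [← ENNReal.rpow_natCast, ← ENNReal.rpow_mul]
    norm_num
  have h := ENNReal.lintegral_mul_le_Lp_mul_Lq P (p := 2) (q := 2)
    ⟨by norm_num, by norm_num, by norm_num⟩
    (f := fun w => ‖W w‖ₑ ^ (1 / 2 : ℝ)) (g := fun w => ‖W w‖ₑ ^ (1 / 2 : ℝ) * ‖u w‖ₑ)
    (by fun_prop) (by fun_prop)
  simp only [Pi.mul_apply, ENNReal.rpow_ofNat, mul_pow, hsq] at h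
  calc ‖∫ w, W w * u w ∂P‖ₑ ^ 2
      ≤ (∫⁻ w, ‖W w‖ₑ ^ (1 / 2 : ℝ) * (‖W w‖ₑ ^ (1 / 2 : ℝ) * ‖u w‖ₑ) ∂P) ^ 2 := by
        gcongr
        refine (enorm_integral_le_lintegral_enorm _).trans_eq ?_
        congr 1
        ext w
        rw [enorm_mul, ← mul_assoc, ← sq, hsq]
    _ ≤ _ := by
        refine (pow_le_pow_left₀ zero_le h 2).trans_eq ?_
        rw [mul_pow, hsq, hsq]

section superposition

variable {n : ℕ} {E : Type*} [MeasurableSpace E] {m m' : E → Rn n → ℂ}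
  {σ : Rn n × Rn n → ℂ} {f g : 𝓢(Rn n, ℂ)}

lemma measurable_superposition_integrand
    (hmm : Measurable fun q : E × Rn n => m q.1 q.2)
    (hmm' : Measurable fun q : E × Rn n => m' q.1 q.2) (hσ : Measurable σ) :
    Measurable fun q : (Rn n × E) × (Rn n × Rn n) =>
      planeWave q.1.1 (q.2.1 + q.2.2) * σ q.2 * (m q.1.2 q.2.1 * ft f q.2.1) *
        (m' q.1.2 q.2.2 * ft g q.2.2) := by
  have hmf := measurable_ft f
  have hmg := measurable_ft g
  have hpw : Measurable fun q : (Rn n × E) × (Rn n × Rn n) =>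
      planeWave q.1.1 (q.2.1 + q.2.2) := 
    measurable_planeWave (by fun_prop) (by fun_prop)
  have hm₁ : Measurable fun q : (Rn n × E) × (Rn n × Rn n) => m q.1.2 q.2.1 := hmm.comp
    (by fun_prop : Measurable fun q : (Rn n × E) × (Rn n × Rn n) => (q.1.2, q.2.1))
  have hm₂ : Measurable fun q : (Rn n × E) × (Rn n × Rn n) => m' q.1.2 q.2.2 := hmm'.comp
    (by fun_prop : Measurable fun q : (Rn n × E) × (Rn n × Rn n) => (q.1.2, q.2.2))
  exact ((hpw.mul (hσ.comp measurable_snd)).mul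
    (hm₁.mul (hmf.comp (measurable_fst.comp measurable_snd)))).mul
    (hm₂.mul (hmg.comp (measurable_snd.comp measurable_snd)))

/-- Fubini for a symbol that is an integral superposition of tensor products. -/
lemma Tbil_superposition {P : Measure E} [SFinite P] {W : E → ℂ} (hW : Measurable W)
    (hWi : Integrable W P) {C : ℝ≥0}
    (hmm : Measurable fun q : E × Rn n => m q.1 q.2)
    (hmm' : Measurable fun q : E × Rn n => m' q.1 q.2)
    (hC : ∀ w ξ, ‖m w ξ‖ ≤ C) (hC' : ∀ w ξ, ‖m' w ξ‖ ≤ C)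
    (hσ : Measurable σ) {D : ℝ} (hD : ∀ p, ‖σ p‖ ≤ D) (x : Rn n) :
    Tbil (fun p => (∫ w, W w * (m w p.1 * m' w p.2) ∂P) * σ p) f g x =
      ∫ w, W w * (∫ p : Rn n × Rn n, planeWave x (p.1 + p.2) * σ p * (m w p.1 * ft f p.1) *
        (m' w p.2 * ft g p.2)) ∂P := by
  have hD0 : 0 ≤ D := (norm_nonneg _).trans (hD 0)
  have hswap : Integrable (fun q : E × (Rn n × Rn n) => W q.1 *
      (planeWave x (q.2.1 + q.2.2) * σ q.2 * (m q.1 q.2.1 * ft f q.2.1) *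
        (m' q.1 q.2.2 * ft g q.2.2))) (P.prod volume) := by
    refine ((hWi.norm.mul_prod (integrable_ft_mul_ft f g)).const_mul (D * C * C)).mono' ?_ ?_
    · have := (measurable_superposition_integrand (f := f) (g := g) hmm hmm' hσ).comp
        (by fun_prop : Measurable fun q : E × (Rn n × Rn n) => ((x, q.1), q.2))
      exact Measurable.aestronglyMeasurable ((hW.comp measurable_fst).mul this)
    · refine Filter.Eventually.of_forall fun q => ?_
      simp only [norm_mul, norm_planeWave, one_mul]
      calc _ ≤ ‖W q.1‖ * (D * (C * ‖ft f q.2.1‖) * (C * ‖ft g q.2.2‖)) := by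
            gcongr
            exacts [hD _, hC _ _, hC' _ _]
        _ = _ := by ring
  simp only [← integral_const_mul]
  rw [integral_integral_swap hswap, Tbil_eq]
  refine integral_congr_ae (Filter.Eventually.of_forall fun p => ?_)
  calc planeWave x (p.1 + p.2) * ((∫ w, W w * (m w p.1 * m' w p.2) ∂P) * σ p) * ft f p.1 *
        ft g p.2
      = (∫ w, W w * (m w p.1 * m' w p.2) ∂P) *
        (planeWave x (p.1 + p.2) * σ p * ft f p.1 * ft g p.2) := by ring
    _ = ∫ w, W w * (planeWave x (p.1 + p.2) * σ p * (m w p.1 * ft f p.1) *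
        (m' w p.2 * ft g p.2)) ∂P := by
      rw [← integral_mul_const]
      refine integral_congr_ae (Filter.Eventually.of_forall fun w => ?_)
      dsimp only
      ring

/-- Minkowski's inequality for the local `L²` norms. -/
lemma localL2_integral_le {P : Measure E} [SFinite P] {W : E → ℂ} (hW : Measurable W)
    (hWi : Integrable W P) {U : Rn n → E → ℂ} (hU : Measurable fun q : Rn n × E => U q.1 q.2)
    {ν : Zn n} {c : ℝ≥0∞} (hc : ∀ w, localL2 (fun x => U x w) ν ≤ c) :
    localL2 (fun x => ∫ w, W w * U x w ∂P) ν ≤ (∫⁻ w, ‖W w‖ₑ ∂P) * c := by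
  have hU' : Measurable fun q : Rn n × E => U (q.1 + coeZ ν) q.2 :=
    hU.comp (by fun_prop : Measurable fun q : Rn n × E => (q.1 + coeZ ν, q.2))
  have hUw : ∀ x, Measurable fun w => U (x + coeZ ν) w := fun x =>
    hU.comp (by fun_prop : Measurable fun w : E => (x + coeZ ν, w))
  rw [localL2_le_iff]
  calc ∫⁻ x in cube n 1, ‖∫ w, W w * U (x + coeZ ν) w ∂P‖ₑ ^ 2
      ≤ ∫⁻ x in cube n 1, ((∫⁻ w, ‖W w‖ₑ ∂P) *
          ∫⁻ w, ‖W w‖ₑ * ‖U (x + coeZ ν) w‖ₑ ^ 2 ∂P) :=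
        lintegral_mono fun x => enorm_integral_mul_sq_le hW (hUw x)
    _ = (∫⁻ w, ‖W w‖ₑ ∂P) * ∫⁻ w, ‖W w‖ₑ *
          (∫⁻ x in cube n 1, ‖U (x + coeZ ν) w‖ₑ ^ 2) ∂P := by
        rw [lintegral_const_mul' _ _ hWi.2.ne, lintegral_lintegral_swap
          (((hW.comp measurable_snd).enorm.mul (hU'.enorm.pow_const 2)).aemeasurable)]
        simp_rw [lintegral_const_mul' _ _ enorm_ne_top]
    _ ≤ (∫⁻ w, ‖W w‖ₑ ∂P) * ∫⁻ w, ‖W w‖ₑ * c ^ 2 ∂P := by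
        gcongr with w
        exact localL2_le_iff.1 (hc w)
    _ = _ := by
        rw [lintegral_mul_const _ hW.enorm]
        ring

/-- Integral superpositions of tensor products of smooth compactly supported symbols act on
multipliers. -/
lemma localL2_Tbil_superposition_le {P : Measure E} [SFinite P] {W : E → ℂ} (hW : Measurable W)
    (hWi : Integrable W P) {C : ℝ≥0}
    (hmm : Measurable fun q : E × Rn n => m q.1 q.2)
    (hmm' : Measurable fun q : E × Rn n => m' q.1 q.2)
    (hm : ∀ w, ContDiff ℝ (⊤ : ℕ∞) (m w)) (hm' : ∀ w, ContDiff ℝ (⊤ : ℕ∞) (m' w))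
    (hs : ∀ w, HasCompactSupport (m w)) (hs' : ∀ w, HasCompactSupport (m' w))
    (hC : ∀ w ξ, ‖m w ξ‖ ≤ C) (hC' : ∀ w ξ, ‖m' w ξ‖ ≤ C)
    (hσ : Measurable σ) {D : ℝ} (hD : ∀ p, ‖σ p‖ ≤ D)
    (hf : eLpNorm f 2 volume = 1) (hg : eLpNorm g 2 volume = 1) (ν : Zn n) :
    localL2 (Tbil (fun p => (∫ w, W w * (m w p.1 * m' w p.2) ∂P) * σ p) f g) ν ≤
      (∫⁻ w, ‖W w‖ₑ ∂P) * (multNorm ⊤ σ * (C * C)) := by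
  rw [funext (Tbil_superposition hW hWi hmm hmm' hC hC' hσ hD)]
  refine localL2_integral_le hW hWi (measurable_superposition_integrand hmm hmm'
    hσ).stronglyMeasurable.integral_prod_right.measurable fun w => ?_
  obtain ⟨F, hF, hFn⟩ := exists_ft_eq_mul (hm w) (hs w) (hC w) f
  obtain ⟨G, hG, hGn⟩ := exists_ft_eq_mul (hm' w) (hs' w) (hC' w) g
  simp only [← hF, ← hG, ← Tbil_eq]
  refine (localL2_Tbil_le σ F G ν).trans ?_
  rw [hf, mul_one] at hFn
  rw [hg, mul_one] at hGn
  gcongr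

end superposition

/-- The lattice points within distance `R` of `ξ` in the supremum norm. -/
def latticeNear {n : ℕ} (R : ℕ) (ξ : Rn n) : Finset (Zn n) :=
  Fintype.piFinset fun i => Finset.Icc ⌈ξ i - R⌉ ⌊ξ i + R⌋

lemma mem_latticeNear {n R : ℕ} {ξ : Rn n} {μ : Zn n} :
    μ ∈ latticeNear R ξ ↔ ‖ξ - coeZ μ‖ ≤ R := by
  rw [pi_norm_le_iff_of_nonneg (Nat.cast_nonneg R)]
  simp only [latticeNear, Fintype.mem_piFinset, Finset.mem_Icc, Int.ceil_le, Int.le_floor, coeZ,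
    Pi.sub_apply, Real.norm_eq_abs, abs_le]
  refine forall_congr' fun i => ?_
  constructor <;> rintro ⟨h₁, h₂⟩ <;> constructor <;> linarith

lemma card_latticeNear_le {n : ℕ} (R : ℕ) (ξ : Rn n) :
    (latticeNear R ξ).card ≤ (2 * R + 1) ^ n := by
  rw [latticeNear, Fintype.card_piFinset]
  refine (Finset.prod_le_pow_card _ _ (2 * R + 1) fun i _ => ?_).trans_eq (by simp)
  have h := Int.floor_le_ceil (ξ i)
  rw [Int.card_Icc, Int.ceil_sub_natCast, Int.floor_add_natCast]
  omega

/-- Boundedly overlapping translates of a bounded function have bounded sums. -/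
lemma norm_sum_translates_le {n R : ℕ} {u : Rn n → ℂ} (hu : ∀ ξ, ‖u ξ‖ ≤ 1)
    (hR : ∀ ξ, u ξ ≠ 0 → ‖ξ‖ ≤ R) {α : Zn n → ℂ} (hα : ∀ μ, ‖α μ‖ ≤ 1) (S : Finset (Zn n))
    (ξ : Rn n) : ‖∑ μ ∈ S, α μ * u (ξ - coeZ μ)‖ ≤ (((2 * R + 1) ^ n : ℕ) : ℝ≥0) := by
  classical
  have h : ∑ μ ∈ S, α μ * u (ξ - coeZ μ) =
      ∑ μ ∈ S ∩ latticeNear R ξ, α μ * u (ξ - coeZ μ) := by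
    refine (Finset.sum_subset Finset.inter_subset_left fun μ hμ hμ' => ?_).symm
    by_contra h0
    exact hμ' (Finset.mem_inter.2 ⟨hμ, mem_latticeNear.2 (hR _ (right_ne_zero_of_mul h0))⟩)
  rw [h]
  calc ‖∑ μ ∈ S ∩ latticeNear R ξ, α μ * u (ξ - coeZ μ)‖
      ≤ ∑ μ ∈ S ∩ latticeNear R ξ, (1 : ℝ) := norm_sum_le_of_le _ fun μ _ => by
        rw [norm_mul]
        exact mul_le_one₀ (hα μ) (norm_nonneg _) (hu _)
    _ = ((S ∩ latticeNear R ξ).card : ℝ) := by simp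
    _ ≤ (((2 * R + 1) ^ n : ℕ) : ℝ) := by
        exact_mod_cast (Finset.card_le_card Finset.inter_subset_right).trans
          (card_latticeNear_le R ξ)
    _ = _ := by simp

/-- A finite sum of translates of a modulated bump function, with coefficients `α`. -/
def modulatedSum {n : ℕ} (φ : Rn n → ℂ) (α : Zn n → ℂ) (S : Finset (Zn n)) (a ξ : Rn n) : ℂ :=
  ∑ μ ∈ S, α μ * (φ (ξ - coeZ μ) * planeWave a (ξ - coeZ μ))

section modulatedSum

variable {n : ℕ} {φ : Rn n → ℂ} {α : Zn n → ℂ} {S : Finset (Zn n)}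

lemma contDiff_modulatedSum (hφ : ContDiff ℝ (⊤ : ℕ∞) φ) (a : Rn n) :
    ContDiff ℝ (⊤ : ℕ∞) (modulatedSum φ α S a) := by
  refine ContDiff.sum fun μ _ => contDiff_const.mul ?_
  have h : ContDiff ℝ (⊤ : ℕ∞) fun ξ : Rn n => ξ - coeZ μ := contDiff_id.sub contDiff_const
  exact (hφ.comp h).mul (contDiff_planeWave.comp (contDiff_const.prodMk h))

lemma hasCompactSupport_modulatedSum (hφ : HasCompactSupport φ) (a : Rn n) :
    HasCompactSupport (modulatedSum φ α S a) := by
  have h : modulatedSum φ α S a =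
      ∑ μ ∈ S, fun ξ => α μ * (φ (ξ - coeZ μ) * planeWave a (ξ - coeZ μ)) := by
    ext ξ
    simp [modulatedSum]
  rw [h]
  refine HasCompactSupport.finset_sum fun μ _ => HasCompactSupport.mul_left ?_
  exact HasCompactSupport.mul_right (hφ.comp_homeomorph (Homeomorph.subRight (coeZ μ)))

lemma measurable_modulatedSum {E : Type*} [MeasurableSpace E] (hφ : Continuous φ) {a : E → Rn n}
    (ha : Measurable a) :
    Measurable fun q : E × Rn n => modulatedSum φ α S (a q.1) q.2 := by
  refine Finset.measurable_fun_sum _ fun μ _ => Measurable.const_mul (Measurable.mul ?_ ?_) _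
  · exact hφ.measurable.comp (measurable_snd.sub_const _)
  · exact measurable_planeWave (ha.comp measurable_fst) (measurable_snd.sub_const _)

lemma norm_modulatedSum_le {R : ℕ} (hφ : ∀ ξ, ‖φ ξ‖ ≤ 1) (hR : ∀ ξ, φ ξ ≠ 0 → ‖ξ‖ ≤ R)
    (hα : ∀ μ, ‖α μ‖ ≤ 1) (a ξ : Rn n) :
    ‖modulatedSum φ α S a ξ‖ ≤ (((2 * R + 1) ^ n : ℕ) : ℝ≥0) :=
  norm_sum_translates_le (u := fun ξ => φ ξ * planeWave a ξ)
    (fun ξ => by rw [norm_mul, norm_planeWave, mul_one]; exact hφ ξ)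
    (fun ξ h => hR ξ (left_ne_zero_of_mul h)) hα S ξ

lemma integral_modulatedSum {E : Type*} [MeasurableSpace E] {P : Measure E} {W : E → ℂ}
    (hW : Integrable W P) {a b : E → Rn n} (ha : Measurable a) (hb : Measurable b)
    {Φ : Rn n × Rn n → ℂ}
    (hΦ : ∀ ξ η, Φ (ξ, η) = ∫ w, W w * (planeWave (a w) ξ * planeWave (b w) η) ∂P)
    (hφ : ∀ ξ η, Φ (ξ, η) ≠ 0 → φ ξ = 1 ∧ φ η = 1) (α' : Zn n → ℂ) (p : Rn n × Rn n) :
    ∫ w, W w * (modulatedSum φ α S (a w) p.1 * modulatedSum φ α' S (b w) p.2) ∂P =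
      ∑ μν ∈ S ×ˢ S, α μν.1 * α' μν.2 * Φ (p.1 - coeZ μν.1, p.2 - coeZ μν.2) := by
  have hint : ∀ ξ η, Integrable (fun w => W w * (planeWave (a w) ξ * planeWave (b w) η)) P := by
    intro ξ η
    refine hW.mul_bdd (c := 1) ?_ (Filter.Eventually.of_forall fun w => ?_)
    · exact ((measurable_planeWave ha measurable_const).mul
        (measurable_planeWave hb measurable_const)).aestronglyMeasurable
    · simp [norm_planeWave]
  have hterm : ∀ w, W w * (modulatedSum φ α S (a w) p.1 * modulatedSum φ α' S (b w) p.2) =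
      ∑ μν ∈ S ×ˢ S, (α μν.1 * α' μν.2 * (φ (p.1 - coeZ μν.1) * φ (p.2 - coeZ μν.2))) *
        (W w * (planeWave (a w) (p.1 - coeZ μν.1) * planeWave (b w) (p.2 - coeZ μν.2))) := by
    intro w
    rw [modulatedSum, modulatedSum, Finset.sum_mul_sum, ← Finset.sum_product', Finset.mul_sum]
    exact Finset.sum_congr rfl fun _ _ => by ring
  simp only [hterm]
  rw [integral_finsetSum _ fun μν _ => (hint _ _).const_mul _]
  refine Finset.sum_congr rfl fun μν _ => ?_
  rw [integral_const_mul, ← hΦ]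
  by_cases h : Φ (p.1 - coeZ μν.1, p.2 - coeZ μν.2) = 0
  · simp [h]
  · simp [hφ _ _ h]

end modulatedSum

lemma exists_nat_norm_le_of_hasCompactSupport {E F : Type*} [NormedAddCommGroup E]
    [NormedAddCommGroup F] {Φ : E → F} (h : HasCompactSupport Φ) :
    ∃ R : ℕ, ∀ p, Φ p ≠ 0 → ‖p‖ ≤ R := by
  obtain ⟨r, hr⟩ := h.isCompact.isBounded.exists_norm_le
  obtain ⟨R, hR⟩ := exists_nat_ge r
  exact ⟨R, fun p hp => (hr p (subset_tsupport _ hp)).trans hR⟩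

/-- A smooth cutoff function, equal to `1` on the ball of radius `R`. -/
lemma exists_cutoff (n R : ℕ) : ∃ φ : Rn n → ℂ, ContDiff ℝ (⊤ : ℕ∞) φ ∧ HasCompactSupport φ ∧
    (∀ ξ, ‖φ ξ‖ ≤ 1) ∧ (∀ ξ, φ ξ ≠ 0 → ‖ξ‖ ≤ (R + 2 : ℕ)) ∧ ∀ ξ, ‖ξ‖ ≤ R → φ ξ = 1 := by
  let b : ContDiffBump (0 : Rn n) := ⟨R + 1, R + 2, by positivity, by linarith⟩
  refine ⟨fun ξ => (b ξ : ℂ), Complex.ofRealCLM.contDiff.comp b.contDiff,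
    b.hasCompactSupport.comp_left Complex.ofReal_zero, fun ξ => ?_, fun ξ h => ?_, fun ξ h => ?_⟩
  · rw [Complex.norm_real, Real.norm_of_nonneg b.nonneg]
    exact b.le_one
  · have hξ : ξ ∈ Function.support b := fun h' => h (by simp [h'])
    rw [b.support_eq, mem_ball_zero_iff] at hξ
    simpa [b] using hξ.le
  · have hξ : ξ ∈ Metric.closedBall 0 b.rIn := by
      rw [mem_closedBall_zero_iff]
      change ‖ξ‖ ≤ R + 1
      linarith
    simp [b.one_of_mem_closedBall hξ]

/-- The lattice points in the cube of half-side `N`. -/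
def latticeCube (n N : ℕ) : Finset (Zn n) :=
  latticeNear N 0

lemma tendsto_sum_latticeCube {n : ℕ} {u : Zn n × Zn n → ℂ} (hu : Summable u) :
    Filter.Tendsto (fun N => ∑ μν ∈ latticeCube n N ×ˢ latticeCube n N, u μν) Filter.atTop
      (nhds (∑' μν, u μν)) := by
  have hmem : ∀ {N : ℕ} {μ : Zn n}, μ ∈ latticeCube n N ↔ ‖coeZ μ‖ ≤ N := by
    simp [latticeCube, mem_latticeNear]
  refine hu.hasSum.comp (Monotone.tendsto_atTop_finset ?_ fun μν => ?_)
  · intro N M hNM μν h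
    simp only [Finset.mem_product, hmem] at h ⊢
    have : (N : ℝ) ≤ M := by exact_mod_cast hNM
    exact ⟨h.1.trans this, h.2.trans this⟩
  · obtain ⟨N, hN⟩ := exists_nat_ge (max ‖(coeZ μν.1 : Rn n)‖ ‖(coeZ μν.2 : Rn n)‖)
    exact ⟨N, Finset.mem_product.2 ⟨hmem.2 ((le_max_left _ _).trans hN),
      hmem.2 ((le_max_right _ _).trans hN)⟩⟩

lemma summable_translates {n R : ℕ} {Φ : Rn n × Rn n → ℂ} (hR : ∀ p, Φ p ≠ 0 → ‖p‖ ≤ R)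
    (α α' : Zn n → ℂ) (p : Rn n × Rn n) :
    Summable fun μν : Zn n × Zn n =>
      α μν.1 * α' μν.2 * Φ (p.1 - coeZ μν.1, p.2 - coeZ μν.2) := by
  refine summable_of_ne_finset_zero (s := latticeNear R p.1 ×ˢ latticeNear R p.2) fun μν h => ?_
  by_contra h0
  have h1 := hR _ (right_ne_zero_of_mul h0)
  exact h (Finset.mem_product.2 ⟨mem_latticeNear.2 ((norm_fst_le _).trans h1),
    mem_latticeNear.2 ((norm_snd_le _).trans h1)⟩)

end

/-- Lemma: making an unconditional family out of one multiplier. -/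
theorem statement6 (n : ℕ) (Φ : Rn n × Rn n → ℂ) (hΦ : IsCcInfty Φ) :
    ∃ c : ℝ≥0∞, c < ∞ ∧
      ∀ σ : Rn n × Rn n → ℂ, Measurable σ → (∃ C : ℝ, ∀ p, ‖σ p‖ ≤ C) →
        ∀ α α' : Zn n → ℂ, (∀ μ, α μ = 0 ∨ α μ = 1) → (∀ ν, α' ν = 0 ∨ α' ν = 1) →
          multNorm ⊤ (fun p : Rn n × Rn n =>
              (∑' μν : Zn n × Zn n,
                α μν.1 * α' μν.2 * Φ (p.1 - coeZ μν.1, p.2 - coeZ μν.2)) * σ p)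
            ≤ c * multNorm ⊤ σ := by
  obtain ⟨W, hWi, hW, hWΦ⟩ := exists_integral_planeWave hΦ
  obtain ⟨R, hR⟩ := exists_nat_norm_le_of_hasCompactSupport hΦ.2
  obtain ⟨φ, hφ, hφs, hφ1, hφR, hφe⟩ := exists_cutoff n R
  set C : ℝ≥0 := (((2 * (R + 2) + 1) ^ n : ℕ) : ℝ≥0)
  refine ⟨(∫⁻ w, ‖W w‖ₑ) * (C * C), ENNReal.mul_lt_top hWi.2 (by finiteness), ?_⟩
  rintro σ hσ ⟨D, hD⟩ α α' hα hα'
  have norm_le : ∀ β : Zn n → ℂ, (∀ μ, β μ = 0 ∨ β μ = 1) → ∀ μ, ‖β μ‖ ≤ 1 := fun β hβ μ => by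
    rcases hβ μ with h | h <;> simp [h]
  set a : EuclideanSpace ℝ (Fin n ⊕ Fin n) → Rn n := fun w i => w (Sum.inl i)
  set b : EuclideanSpace ℝ (Fin n ⊕ Fin n) → Rn n := fun w i => w (Sum.inr i)
  have ha : Measurable a := by fun_prop
  have hb : Measurable b := by fun_prop
  have hcut : ∀ ξ η, Φ (ξ, η) ≠ 0 → φ ξ = 1 ∧ φ η = 1 := fun ξ η h =>
    ⟨hφe ξ ((norm_fst_le (ξ, η)).trans (hR _ h)), hφe η ((norm_snd_le (ξ, η)).trans (hR _ h))⟩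
  have key : ∀ (S : Finset (Zn n)) (p : Rn n × Rn n),
      ∫ w, W w * (modulatedSum φ α S (a w) p.1 * modulatedSum φ α' S (b w) p.2) =
        ∑ μν ∈ S ×ˢ S, α μν.1 * α' μν.2 * Φ (p.1 - coeZ μν.1, p.2 - coeZ μν.2) := fun S p =>
    integral_modulatedSum hWi ha hb hWΦ hcut α' p
  rw [multNorm_top_le_iff]
  intro f g hf hg ν
  refine localL2_Tbil_le_of_tendsto (σ := fun N p => (∑ μν ∈ latticeCube n N ×ˢ latticeCube n N,
      α μν.1 * α' μν.2 * Φ (p.1 - coeZ μν.1, p.2 - coeZ μν.2)) * σ p)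
    (C := (∫ w, ‖W w‖) * (C * C) * D) (fun N => ?_) (fun N p => ?_)
    (fun p => (tendsto_sum_latticeCube (summable_translates hR α α' p)).mul_const _) f g ν
    (fun N => ?_)
  · refine Measurable.mul (Finset.measurable_fun_sum _ fun μν _ => Measurable.const_mul ?_ _) hσ
    exact hΦ.1.continuous.measurable.comp
      ((measurable_fst.sub_const _).prodMk (measurable_snd.sub_const _))
  · rw [norm_mul]
    refine mul_le_mul ?_ (hD p) (norm_nonneg _) (by positivity)
    rw [← key, ← integral_mul_const]
    refine norm_integral_le_of_norm_le (hWi.norm.mul_const _)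
      (Filter.Eventually.of_forall fun w => ?_)
    rw [norm_mul, norm_mul]
    gcongr
    · exact norm_modulatedSum_le hφ1 hφR (norm_le α hα) _ _
    · exact norm_modulatedSum_le hφ1 hφR (norm_le α' hα') _ _
  · simp only [← key]
    refine (localL2_Tbil_superposition_le hW hWi (m := fun w => modulatedSum φ α _ (a w))
      (m' := fun w => modulatedSum φ α' _ (b w)) (C := C)
      (measurable_modulatedSum hφ.continuous ha) (measurable_modulatedSum hφ.continuous hb)
      (fun w => contDiff_modulatedSum hφ _) (fun w => contDiff_modulatedSum hφ _)
      (fun w => hasCompactSupport_modulatedSum hφs _)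
      (fun w => hasCompactSupport_modulatedSum hφs _)
      (fun w => norm_modulatedSum_le hφ1 hφR (norm_le α hα) _)
      (fun w => norm_modulatedSum_le hφ1 hφR (norm_le α' hα') _) hσ hD hf hg ν).trans_eq ?_
    ring
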